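/- The plane sextic C defined by X⁶ + Y⁵Z + XZ⁵ = 0 is smooth over K, and its automorphism group Aut(C) ⊂ PGL₃(K) is cyclic of order 25, generated by diag(1, ζ₂₅, ζ₂₅²⁰). -/

import Mathlib

open MvPolynomial

/-- `GL₃(K)`: the group of invertible `3 × 3` matrices over `K`. -/
abbrev GL3 (K : Type*) [Field K] := (Matrix (Fin 3) (Fin 3) K)ˣ

/-- `PGL₃(K)`: the quotient of `GL₃(K)` by its center (the scalar matrices). -/
abbrev PGL3 (K : Type*) [Field K] := GL3 K ⧸ Subgroup.center (GL3 K)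

variable {K : Type*} [Field K]

/-- The substitution `F(X,Y,Z) ↦ F(A·(X,Y,Z)ᵗ)` for a `3 × 3` matrix `A`. -/
noncomputable def matAct (A : Matrix (Fin 3) (Fin 3) K) (F : MvPolynomial (Fin 3) K) :
    MvPolynomial (Fin 3) K :=
  aeval (fun i => ∑ j, C (A i j) * X j) F

lemma matAct_one (F : MvPolynomial (Fin 3) K) : matAct 1 F = F := by
  unfold matAct
  have h : (fun i => ∑ j, C ((1 : Matrix (Fin 3) (Fin 3) K) i j) * X j)
      = (X : Fin 3 → MvPolynomial (Fin 3) K) := by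
    funext i
    rw [Finset.sum_eq_single i]
    · simp
    · intro b _ hb
      simp [Matrix.one_apply, Ne.symm hb]
    · simp
  rw [h, aeval_X_left_apply]

lemma matAct_matAct (A B : Matrix (Fin 3) (Fin 3) K) (F : MvPolynomial (Fin 3) K) :
    matAct B (matAct A F) = matAct (A * B) F := by
  unfold matAct
  rw [← AlgHom.comp_apply, comp_aeval]
  have h : (fun i => (aeval fun i => ∑ j, C (B i j) * X j) (∑ j, C (A i j) * X j))
      = fun i => ∑ j : Fin 3, C ((A * B) i j) * (X j : MvPolynomial (Fin 3) K) := by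
    funext i
    simp only [map_sum, map_mul, aeval_C, aeval_X, algebraMap_eq, Finset.mul_sum]
    rw [Finset.sum_comm]
    refine Finset.sum_congr rfl fun k _ => ?_
    rw [Matrix.mul_apply, map_sum, Finset.sum_mul]
    refine Finset.sum_congr rfl fun j _ => ?_
    rw [map_mul, mul_assoc]
  rw [h]

lemma matAct_smul (A : Matrix (Fin 3) (Fin 3) K) (c : K) (F : MvPolynomial (Fin 3) K) :
    matAct A (c • F) = c • matAct A F :=
  map_smul (aeval fun i => ∑ j, C (A i j) * X j) c F

/-- The class of a matrix `A` in `PGL₃(K)` (junk value `1` if `A` is not invertible). -/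
noncomputable def pgl (A : Matrix (Fin 3) (Fin 3) K) : PGL3 K := by
  classical
  exact if h : IsUnit A then (QuotientGroup.mk h.unit : PGL3 K) else 1

/-- `F` defines a smooth plane sextic: `F` is homogeneous of degree `6`, and `F` together with
its partial derivatives have no common zero besides the origin. -/
def IsSmoothSextic (F : MvPolynomial (Fin 3) K) : Prop :=
  F.IsHomogeneous 6 ∧
    ∀ p : Fin 3 → K, eval p F = 0 → (∀ i, eval p (pderiv i F) = 0) → p = 0

/-- The automorphism group of the plane curve `F = 0`: the subgroup of `PGL₃(K)` consisting of
the classes of matrices `A ∈ GL₃(K)` with `F(A·(X,Y,Z)ᵗ) = λ·F(X,Y,Z)` for some `λ ∈ K×`. -/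
noncomputable def planeAut (F : MvPolynomial (Fin 3) K) : Subgroup (PGL3 K) where
  carrier := {g | ∃ A : GL3 K, (QuotientGroup.mk A : PGL3 K) = g ∧
    ∃ c : K, c ≠ 0 ∧ matAct (A : Matrix (Fin 3) (Fin 3) K) F = c • F}
  one_mem' := ⟨1, rfl, 1, one_ne_zero, by rw [Units.val_one, matAct_one, one_smul]⟩
  mul_mem' := by
    rintro g h ⟨A, rfl, c, hc, hA⟩ ⟨B, rfl, d, hd, hB⟩
    exact ⟨A * B, rfl, c * d, mul_ne_zero hc hd, by
      rw [Units.val_mul, ← matAct_matAct, hA, matAct_smul, hB, smul_smul]⟩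
  inv_mem' := by
    rintro g ⟨A, rfl, c, hc, hA⟩
    refine ⟨A⁻¹, rfl, c⁻¹, inv_ne_zero hc, ?_⟩
    rw [eq_inv_smul_iff₀ hc, ← matAct_smul, ← hA, matAct_matAct, ← Units.val_mul,
      mul_inv_cancel, Units.val_one, matAct_one]

open Matrix in
/-- Evaluating `F(A·x)` at `p` amounts to evaluating `F` at `A·p`. -/
lemma eval_matAct (A : Matrix (Fin 3) (Fin 3) K) (G : MvPolynomial (Fin 3) K) (p : Fin 3 → K) :
    eval p (matAct A G) = eval (A *ᵥ p) G := by
  induction G using MvPolynomial.induction_on with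
  | C a => simp [matAct]
  | add f g hf hg =>
    simp only [matAct, map_add] at hf hg ⊢
    rw [hf, hg]
  | mul_X f i hf =>
    simp only [matAct, map_mul, aeval_X] at hf ⊢
    rw [hf]
    simp [Matrix.mulVec, dotProduct]

/-- The chain rule for a linear substitution. -/
lemma pderiv_matAct (A : Matrix (Fin 3) (Fin 3) K) (G : MvPolynomial (Fin 3) K) (i : Fin 3) :
    pderiv i (matAct A G) = ∑ j, C (A j i) * matAct A (pderiv j G) := by
  induction G using MvPolynomial.induction_on with
  | C a => simp [matAct]
  | add f g hf hg =>
    simp only [matAct, map_add] at hf hg ⊢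
    rw [hf, hg, ← Finset.sum_add_distrib]
    exact Finset.sum_congr rfl fun j _ => (mul_add _ _ _).symm
  | mul_X f k hf =>
    have hX : pderiv i (∑ j, C (A k j) * X j : MvPolynomial (Fin 3) K) = C (A k i) := by
      simp [pderiv_X, Pi.single_apply]
    have hs : ∀ j, matAct A (pderiv j (f * X k)) = matAct A (pderiv j f) * (∑ l, C (A k l) * X l)
        + if k = j then matAct A f else 0 := by
      intro j
      rw [pderiv_mul, pderiv_X, Pi.single_apply]
      split_ifs <;> simp_all [matAct]
    have hm : matAct A (f * X k) = matAct A f * ∑ l, C (A k l) * X l := by simp [matAct]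
    simp only [hs, mul_add, Finset.sum_add_distrib, mul_ite, mul_zero, Finset.sum_ite_eq,
      Finset.mem_univ, if_true]
    rw [hm, pderiv_mul, hf, hX, Finset.sum_mul, mul_comm (C (A k i))]
    simp only [mul_assoc]

/-- The gradient of `G` at the point `p`. -/
noncomputable def gradientAt (G : MvPolynomial (Fin 3) K) (p : Fin 3 → K) : Fin 3 → K :=
  fun i => eval p (pderiv i G)

/-- The Hessian matrix of `G` at the point `p`. -/
noncomputable def hessianAt (G : MvPolynomial (Fin 3) K) (p : Fin 3 → K) :
    Matrix (Fin 3) (Fin 3) K :=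
  Matrix.of fun i j => eval p (pderiv i (pderiv j G))

open Matrix in
lemma transpose_mulVec_gradientAt {A : Matrix (Fin 3) (Fin 3) K} {G : MvPolynomial (Fin 3) K}
    {c : K} (h : matAct A G = c • G) (p : Fin 3 → K) :
    Aᵀ *ᵥ gradientAt G (A *ᵥ p) = c • gradientAt G p := by
  ext i
  have := congrArg (fun P => eval p (pderiv i P)) h
  simpa [pderiv_matAct, eval_matAct, gradientAt, Matrix.mulVec, dotProduct, smul_eval] using this

open Matrix in
lemma transpose_mul_hessianAt_mul {A : Matrix (Fin 3) (Fin 3) K} {G : MvPolynomial (Fin 3) K}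
    {c : K} (h : matAct A G = c • G) (p : Fin 3 → K) :
    Aᵀ * hessianAt G (A *ᵥ p) * A = c • hessianAt G p := by
  ext i j
  have := congrArg (fun P => eval p (pderiv i (pderiv j P))) h
  simp only [pderiv_matAct, map_sum, pderiv_C_mul, map_mul, eval_C, eval_matAct,
    Derivation.map_smul, smul_eval] at this
  simp only [Matrix.mul_apply, Matrix.transpose_apply, hessianAt, Matrix.of_apply,
    Matrix.smul_apply, smul_eq_mul, ← this, Finset.sum_mul, Finset.mul_sum]
  exact Finset.sum_congr rfl fun _ _ => Finset.sum_congr rfl fun _ _ => by ring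

/-- The sextic form `X⁶ + Y⁵Z + XZ⁵`. -/
local notation "sextic" K:max => (X 0 ^ 6 + X 1 ^ 5 * X 2 + X 0 * X 2 ^ 5 : MvPolynomial (Fin 3) K)

lemma gradientAt_sextic (p : Fin 3 → K) :
    gradientAt (sextic K) p =
      ![6 * p 0 ^ 5 + p 2 ^ 5, 5 * p 1 ^ 4 * p 2, p 1 ^ 5 + 5 * p 0 * p 2 ^ 4] := by
  ext i
  fin_cases i <;> simp [gradientAt, pderiv_X] <;> ring

lemma hessianAt_sextic (p : Fin 3 → K) :
    hessianAt (sextic K) p =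
      !![30 * p 0 ^ 4, 0, 5 * p 2 ^ 4;
         0, 20 * p 1 ^ 3 * p 2, 5 * p 1 ^ 4;
         5 * p 2 ^ 4, 5 * p 1 ^ 4, 20 * p 0 * p 2 ^ 3] := by
  have h5 : ∀ i, pderiv i (5 : MvPolynomial (Fin 3) K) = 0 := fun i =>
    (pderiv i).map_natCast 5
  have h6 : ∀ i, pderiv i (6 : MvPolynomial (Fin 3) K) = 0 := fun i =>
    (pderiv i).map_natCast 6
  ext i j
  fin_cases i <;> fin_cases j <;> simp [hessianAt, pderiv_X, h5, h6] <;> ring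

lemma isHomogeneous_sextic : (sextic K).IsHomogeneous 6 := by
  refine ((isHomogeneous_X_pow 0 6).add ?_).add ?_
  · exact (isHomogeneous_X_pow 1 5).mul (isHomogeneous_X K 2)
  · exact (isHomogeneous_X K 0).mul (isHomogeneous_X_pow 2 5)

lemma isSmoothSextic_sextic [CharZero K] : IsSmoothSextic (sextic K) := by
  refine ⟨isHomogeneous_sextic, fun p _ hd => ?_⟩
  have hg : gradientAt (sextic K) p = 0 := funext hd
  rw [gradientAt_sextic] at hg
  have h0 : 6 * p 0 ^ 5 + p 2 ^ 5 = 0 := congrFun hg 0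
  have h1 : 5 * p 1 ^ 4 * p 2 = 0 := congrFun hg 1
  have h2 : p 1 ^ 5 + 5 * p 0 * p 2 ^ 4 = 0 := congrFun hg 2
  have hz : p 2 = 0 := by
    by_contra hz
    have hy : p 1 = 0 := by simpa [hz] using h1
    have hx : p 0 = 0 := by simpa [hy, hz] using h2
    simp [hx, hz] at h0
  have hx : p 0 = 0 := by simpa [hz] using h0
  have hy : p 1 = 0 := by simpa [hz] using h2
  ext i
  fin_cases i <;> assumption

/-- Where the Hessian matrix of the sextic has rank at most one, `Y` vanishes. -/
lemma snd_eq_zero_of_hessianAt_sextic_eq [CharZero K] {p u v : Fin 3 → K}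
    (h : hessianAt (sextic K) p = Matrix.vecMulVec u v) : p 1 = 0 := by
  rw [hessianAt_sextic] at h
  have e : ∀ i j, _ = u i * v j := fun i j => congrFun (congrFun h i) j
  have h00 : 30 * p 0 ^ 4 = u 0 * v 0 := e 0 0
  have h01 : 0 = u 0 * v 1 := e 0 1
  have h02 : 5 * p 2 ^ 4 = u 0 * v 2 := e 0 2
  have h11 : 20 * p 1 ^ 3 * p 2 = u 1 * v 1 := e 1 1
  have h12 : 5 * p 1 ^ 4 = u 1 * v 2 := e 1 2
  have h20 : 5 * p 2 ^ 4 = u 2 * v 0 := e 2 0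
  have h21 : 5 * p 1 ^ 4 = u 2 * v 1 := e 2 1
  have h22 : 20 * p 0 * p 2 ^ 3 = u 2 * v 2 := e 2 2
  by_contra hy
  have hv : v 1 ≠ 0 := fun hv => by simp [hv, hy] at h21
  have hu : u 0 = 0 := by simpa [hv] using h01.symm
  have hz : p 2 = 0 := by simpa [hu] using h02
  have h25 : (5 * p 1 ^ 4) * (5 * p 1 ^ 4) = (20 * p 1 ^ 3 * p 2) * (20 * p 0 * p 2 ^ 3) := by
    rw [h11, h22]; nth_rewrite 1 [h12]; rw [h21]; ring
  simp [hz, hy] at h25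

open Matrix in
/-- A linear substitution preserving the sextic up to a scalar is diagonal. -/
lemma eq_diagonal_of_matAct_sextic [IsAlgClosed K] [CharZero K] (A : GL3 K) {c : K}
    (h : matAct (A : Matrix (Fin 3) (Fin 3) K) (sextic K) = c • sextic K) :
    ∃ a b d : K, (A : Matrix (Fin 3) (Fin 3) K) = diagonal ![a, b, d] ∧
      a ^ 6 = c ∧ b ^ 5 * d = c ∧ a * d ^ 5 = c := by
  obtain ⟨M, N, hMN, hNM⟩ := A
  simp only at h ⊢
  have hrank : ∀ p u v : Fin 3 → K, hessianAt (sextic K) p = vecMulVec u v →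
      (M *ᵥ p) 1 = 0 := by
    intro p u v hp
    have hH := transpose_mul_hessianAt_mul h p
    have hH' : hessianAt (sextic K) (M *ᵥ p) = Nᵀ * (c • hessianAt (sextic K) p) * N := by
      have hT : Nᵀ * Mᵀ = 1 := by rw [← transpose_mul, hMN, transpose_one]
      rw [← hH, Matrix.mul_assoc, Matrix.mul_assoc, Matrix.mul_assoc, hMN, Matrix.mul_one,
        ← Matrix.mul_assoc, hT, Matrix.one_mul]
    refine snd_eq_zero_of_hessianAt_sextic_eq (u := Nᵀ *ᵥ (c • u)) (v := v ᵥ* N) ?_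
    rw [hH', hp, ← smul_vecMulVec, mul_vecMulVec, vecMulVec_mul]
  have h10 : M 1 0 = 0 := by
    have := hrank ![1, 0, 0] ![30, 0, 0] ![1, 0, 0] (by
      rw [hessianAt_sextic]
      ext i j
      fin_cases i <;> fin_cases j <;> simp [vecMulVec])
    simpa [mulVec, dotProduct, Fin.sum_univ_three] using this
  have h12 : M 1 2 = 0 := by
    obtain ⟨θ, hθ⟩ := IsAlgClosed.exists_pow_nat_eq (24 : K) (n := 5) (by norm_num)
    have hθ0 : θ ≠ 0 := by rintro rfl; norm_num at hθ
    have := hrank ![1, 0, θ] ![30, 0, 5 * θ ^ 4] ![1, 0, θ ^ 4 / 6] (by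
      rw [hessianAt_sextic]
      ext i j
      fin_cases i <;> fin_cases j <;> simp [vecMulVec]
      · ring
      · linear_combination (-5 / 6) * θ ^ 3 * hθ)
    simpa [mulVec, dotProduct, Fin.sum_univ_three, h10, hθ0] using this
  have h11 : M 1 1 ≠ 0 := by
    intro h11
    have := congrFun (congrFun hMN 1) 1
    simp [Matrix.mul_apply, Fin.sum_univ_three, h10, h11, h12] at this
  have hgrad : ∀ p i, (Mᵀ *ᵥ gradientAt (sextic K) (M *ᵥ p)) i
      = c * gradientAt (sextic K) p i := fun p i =>
    congrFun (transpose_mulVec_gradientAt h p) i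
  have hline : ∀ x z : K, M 0 1 * (6 * x ^ 5 + z ^ 5) + M 2 1 * (5 * x * z ^ 4) = 0 := by
    intro x z
    have hq : M *ᵥ (N *ᵥ ![x, 0, z]) = ![x, 0, z] := by rw [mulVec_mulVec, hMN, one_mulVec]
    have hy : (N *ᵥ ![x, 0, z]) 1 = 0 := by
      have := congrFun hq 1
      rw [mulVec, dotProduct, Fin.sum_univ_three] at this
      simpa [h10, h12, h11] using this
    have := hgrad (N *ᵥ ![x, 0, z]) 1
    rw [hq, gradientAt_sextic, gradientAt_sextic] at this
    simp only [hy] at this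
    simpa [mulVec, dotProduct, Fin.sum_univ_three] using this
  have h01 : M 0 1 = 0 := by simpa using hline 1 0
  have h21 : M 2 1 = 0 := by simpa [h01] using hline 1 1
  have h20 : M 2 0 = 0 := by
    have := hgrad ![1, 1, 0] 1
    simpa [gradientAt_sextic, mulVec, dotProduct, Fin.sum_univ_three, h01, h21, h10, h11, h12]
      using this
  have h00 : M 0 0 ≠ 0 := by
    intro h00
    have := congrFun (congrFun hNM 0) 0
    simp [Matrix.mul_apply, Fin.sum_univ_three, h00, h10, h20] at this
  have h02 : M 0 2 = 0 := by
    have := hgrad ![1, 0, 0] 2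
    simpa [gradientAt_sextic, mulVec, dotProduct, Fin.sum_univ_three, h00, h20, h10]
      using this
  have hM : M = diagonal ![M 0 0, M 1 1, M 2 2] := by
    ext i j
    fin_cases i <;> fin_cases j <;> simp [h01, h02, h10, h12, h20, h21]
  have hval : ∀ p : Fin 3 → K, eval (M *ᵥ p) (sextic K) = c * eval p (sextic K) := fun p => by
    rw [← eval_matAct, h, smul_eval]
  have hx : M 0 0 ^ 6 = c := by
    simpa [mulVec, dotProduct, Fin.sum_univ_three, h10, h20] using hval ![1, 0, 0]
  have hy : M 1 1 ^ 5 * M 2 2 = c := by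
    simpa [mulVec, dotProduct, Fin.sum_univ_three, h01, h02, h10, h12, h20, h21]
      using hval ![0, 1, 1]
  have hz : M 0 0 ^ 6 + M 0 0 * M 2 2 ^ 5 = c * (1 + 1) := by
    simpa [mulVec, dotProduct, Fin.sum_univ_three, h01, h02, h10, h12, h20, h21]
      using hval ![1, 0, 1]
  exact ⟨_, _, _, hM, hx, hy, by linear_combination hz - hx⟩

lemma matAct_diagonal_sextic {a b d c : K} (hx : a ^ 6 = c) (hy : b ^ 5 * d = c)
    (hz : a * d ^ 5 = c) :
    matAct (Matrix.diagonal ![a, b, d]) (sextic K) = c • sextic K := by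
  have h0 : (∑ j, C (Matrix.diagonal ![a, b, d] 0 j) * X j : MvPolynomial (Fin 3) K)
      = C a * X 0 := by simp [Fin.sum_univ_three]
  have h1 : (∑ j, C (Matrix.diagonal ![a, b, d] 1 j) * X j : MvPolynomial (Fin 3) K)
      = C b * X 1 := by simp [Fin.sum_univ_three]
  have h2 : (∑ j, C (Matrix.diagonal ![a, b, d] 2 j) * X j : MvPolynomial (Fin 3) K)
      = C d * X 2 := by simp [Fin.sum_univ_three]
  simp only [matAct, map_add, map_mul, map_pow, aeval_X, h0, h1, h2, smul_eq_C_mul]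
  have hx' : (C a ^ 6 : MvPolynomial (Fin 3) K) = C c := by rw [← hx, map_pow]
  have hy' : (C b ^ 5 * C d : MvPolynomial (Fin 3) K) = C c := by rw [← hy, map_mul, map_pow]
  have hz' : (C a * C d ^ 5 : MvPolynomial (Fin 3) K) = C c := by rw [← hz, map_mul, map_pow]
  linear_combination X 0 ^ 6 * hx' + X 1 ^ 5 * X 2 * hy' + X 0 * X 2 ^ 5 * hz'

lemma pgl_coe (A : GL3 K) :
    pgl (A : Matrix (Fin 3) (Fin 3) K) = (QuotientGroup.mk A : PGL3 K) := by
  rw [pgl, dif_pos A.isUnit]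
  congr
  exact Units.ext rfl

/-- An invertible matrix with scalar underlying matrix is central. -/
lemma mem_center_of_coe_eq_smul_one {A : GL3 K} {a : K}
    (h : (A : Matrix (Fin 3) (Fin 3) K) = a • 1) : A ∈ Subgroup.center (GL3 K) := by
  rw [Subgroup.mem_center_iff]
  intro g
  ext1
  simp [h]

/-- The first two diagonal entries of a central diagonal matrix coincide. -/
lemma eq_of_diagonal_mem_center {A : GL3 K} {a b d : K}
    (h : (A : Matrix (Fin 3) (Fin 3) K) = Matrix.diagonal ![a, b, d])
    (hA : A ∈ Subgroup.center (GL3 K)) : a = b := by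
  rw [Subgroup.mem_center_iff] at hA
  let T : GL3 K := ⟨!![1, 1, 0; 0, 1, 0; 0, 0, 1], !![1, -1, 0; 0, 1, 0; 0, 0, 1],
    by simp [Matrix.one_fin_three],
    by simp [Matrix.one_fin_three]⟩
  have := congrArg (fun B : GL3 K => (B : Matrix (Fin 3) (Fin 3) K) 0 1) (hA T)
  simpa [T, h, Matrix.mul_apply, Fin.sum_univ_three] using this.symm

/-- The diagonal matrix `diag(1, ζ, ζ²⁰)` for a unit `ζ`. -/
def diagUnit (ζ : Kˣ) : GL3 K :=
  Units.map (Matrix.diagonalRingHom (Fin 3) K).toMonoidHom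
    (MulEquiv.piUnits.symm ![1, ζ, ζ ^ 20])

lemma coe_diagUnit_pow (ζ : Kˣ) (n : ℕ) :
    ((diagUnit ζ ^ n : GL3 K) : Matrix (Fin 3) (Fin 3) K) =
      Matrix.diagonal ![1, (ζ : K) ^ n, (ζ : K) ^ (20 * n)] := by
  have h1 : ((diagUnit ζ : GL3 K) : Matrix (Fin 3) (Fin 3) K) =
      Matrix.diagonal ![1, (ζ : K), (ζ : K) ^ 20] := by
    ext i j
    fin_cases i <;> fin_cases j <;> simp [diagUnit]
  rw [Units.val_pow_eq_pow_val, h1, Matrix.diagonal_pow]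
  congr 1
  ext i
  fin_cases i <;> simp [pow_mul]

/-- The sextic `X⁶ + Y⁵Z + XZ⁵` is smooth and its automorphism group is cyclic of
order `25`, generated by `diag(1, ζ₂₅, ζ₂₅²⁰)`. -/
theorem typeTwentyFive_sextic_automorphisms {K : Type*} [Field K] [IsAlgClosed K] [CharZero K]
    (ζ : K) (hζ : IsPrimitiveRoot ζ 25) :
    IsSmoothSextic (X 0 ^ 6 + X 1 ^ 5 * X 2 + X 0 * X 2 ^ 5 : MvPolynomial (Fin 3) K) ∧
    planeAut (X 0 ^ 6 + X 1 ^ 5 * X 2 + X 0 * X 2 ^ 5 : MvPolynomial (Fin 3) K)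
      = Subgroup.zpowers (pgl !![1, 0, 0; 0, ζ, 0; 0, 0, ζ ^ 20]) ∧
    Nat.card ↥(planeAut (X 0 ^ 6 + X 1 ^ 5 * X 2 + X 0 * X 2 ^ 5 : MvPolynomial (Fin 3) K))
      = 25 := by
  have h25 : ζ ^ 25 = 1 := hζ.pow_eq_one
  have hζ0 : ζ ≠ 0 := hζ.ne_zero (by norm_num)
  obtain ⟨w, rfl⟩ : ∃ w : Kˣ, (w : K) = ζ := ⟨Units.mk0 ζ hζ0, rfl⟩
  have hpgl : pgl !![1, 0, 0; 0, (w : K), 0; 0, 0, (w : K) ^ 20]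
      = (QuotientGroup.mk (diagUnit w) : PGL3 K) := by
    rw [← pgl_coe]
    congr 1
    rw [← pow_one (diagUnit w), coe_diagUnit_pow]
    ext i j
    fin_cases i <;> fin_cases j <;> simp
  have hgroup : planeAut (sextic K)
      = Subgroup.zpowers (QuotientGroup.mk (diagUnit w) : PGL3 K) := by
    apply le_antisymm
    · rintro _ ⟨A, rfl, c, hc, hA⟩
      obtain ⟨a, b, d, hM, hx, hy, hz⟩ := eq_diagonal_of_matAct_sextic A hA
      have ha : a ≠ 0 := by rintro rfl; exact hc (by simp [← hx])
      have hd : (d / a) ^ 5 = 1 := by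
        rw [div_pow, div_eq_one_iff_eq (pow_ne_zero 5 ha)]
        exact mul_left_cancel₀ ha (by rw [hz, ← hx]; ring)
      have hbd : (b / a) ^ 5 * (d / a) = 1 := by
        rw [div_pow, div_mul_div_comm, div_eq_one_iff_eq (by positivity), hy, ← hx]
        ring
      have hb : (b / a) ^ 25 = 1 := by
        have := congrArg (· ^ 5) hbd
        simpa [mul_pow, hd, ← pow_mul] using this
      obtain ⟨k, -, hk⟩ := hζ.eq_pow_of_pow_eq_one hb
      have hd' : d / a = (w : K) ^ (20 * k) := by
        rw [mul_comm, pow_mul, hk]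
        linear_combination (b / a) ^ 20 * hbd - (d / a) * hb
      refine ⟨k, ?_⟩
      change (QuotientGroup.mk (diagUnit w) : PGL3 K) ^ (k : ℤ) = _
      rw [zpow_natCast, ← QuotientGroup.mk_pow, QuotientGroup.eq]
      refine mem_center_of_coe_eq_smul_one (a := a) ?_
      rw [Units.val_mul, Units.inv_mul_eq_iff_eq_mul, hM, coe_diagUnit_pow, hk, ← hd']
      ext i j
      fin_cases i <;> fin_cases j <;> simp <;> field_simp
    · rw [Subgroup.zpowers_le]
      refine ⟨diagUnit w, rfl, 1, one_ne_zero, ?_⟩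
      rw [← pow_one (diagUnit w), coe_diagUnit_pow]
      refine matAct_diagonal_sextic (one_pow 6) ?_ ?_
      · linear_combination h25
      · linear_combination ((w : K) ^ 75 + (w : K) ^ 50 + (w : K) ^ 25 + 1) * h25
  refine ⟨isSmoothSextic_sextic, by rw [hgroup, hpgl], ?_⟩
  rw [hgroup, Nat.card_zpowers]
  have : Fact (Nat.Prime 5) := ⟨by norm_num⟩
  refine orderOf_eq_prime_pow (p := 5) (n := 1) ?_ ?_
  · rw [← QuotientGroup.mk_pow, QuotientGroup.eq_one_iff]
    intro hmem
    have := eq_of_diagonal_mem_center (coe_diagUnit_pow w _) hmem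
    exact hζ.pow_ne_one_of_pos_of_lt (by norm_num) (by norm_num) this.symm
  · rw [← QuotientGroup.mk_pow, QuotientGroup.eq_one_iff]
    refine mem_center_of_coe_eq_smul_one (a := 1) ?_
    rw [coe_diagUnit_pow, mul_comm, pow_mul]
    norm_num [h25]
    ext i
    fin_cases i <;> simp
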